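/- Let R be an algebraic curvature tensor on E with nonnegative isotropic curvature, and suppose the orthonormal four-frame {e_1,e_2,e_3,e_4} attains isotropic curvature zero. Then Σ_{p,q=5}^n (R_{1p1q} + R_{2p2q})(R_{3p3q} + R_{4p4q}) - Σ_{p,q=5}^n R_{12pq} R_{34pq} ≥ Σ_{p,q=5}^n (R_{1p3q} + R_{2p4q})(R_{3p1q} + R_{4p2q}) + Σ_{p,q=5}^n (R_{1p4q} - R_{2p3q})(R_{4p1q} - R_{3p2q}). -/

import Mathlib

open scoped BigOperators
open RealInnerProductSpace

noncomputable section

abbrev Euc (n : ℕ) : Type := EuclideanSpace ℝ (Fin n)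

/-- The space of quadrilinear (multilinear) maps `E → E → E → E → ℝ`. -/
abbrev CurvMap (n : ℕ) : Type := Euc n →ₗ[ℝ] Euc n →ₗ[ℝ] Euc n →ₗ[ℝ] Euc n →ₗ[ℝ] ℝ

/-- `R` is an algebraic curvature tensor: antisymmetric in the first two arguments,
symmetric under interchange of the first and second pair, and satisfying the
first Bianchi identity. -/
def IsCurvatureTensor {n : ℕ} (R : CurvMap n) : Prop :=
  (∀ x y z w : Euc n, R x y z w = - R y x z w) ∧
  (∀ x y z w : Euc n, R x y z w = R z w x y) ∧
  (∀ x y z w : Euc n, R x y z w + R y z x w + R z x y w = 0)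

/-- Nonnegative isotropic curvature for a quadrilinear form on `EuclideanSpace ℝ (Fin m)`. -/
def NonnegIsotropic {m : ℕ} (R : Euc m → Euc m → Euc m → Euc m → ℝ) : Prop :=
  ∀ v₁ v₂ v₃ v₄ : Euc m, Orthonormal ℝ ![v₁, v₂, v₃, v₄] →
    0 ≤ R v₁ v₃ v₁ v₃ + R v₁ v₄ v₁ v₄ + R v₂ v₃ v₂ v₃ + R v₂ v₄ v₂ v₄ - 2 * R v₁ v₂ v₃ v₄

/-- The isotropic curvature expression of `R`, for arbitrary vectors. -/
def isotropicForm {n : ℕ} (R : CurvMap n) (x₁ x₂ x₃ x₄ : Euc n) : ℝ :=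
  R x₁ x₃ x₁ x₃ + R x₁ x₄ x₁ x₄ + R x₂ x₃ x₂ x₃ + R x₂ x₄ x₂ x₄ - 2 * R x₁ x₂ x₃ x₄

/-- The vectors `x₁ + i x₂` and `x₃ + i x₄` span a totally isotropic subspace of the
complexification. -/
structure IsotropicPair {V : Type*} [NormedAddCommGroup V] [InnerProductSpace ℝ V]
    (x₁ x₂ x₃ x₄ : V) : Prop where
  inner_12 : ⟪x₁, x₂⟫ = 0
  inner_11 : ⟪x₁, x₁⟫ = ⟪x₂, x₂⟫
  inner_34 : ⟪x₃, x₄⟫ = 0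
  inner_33 : ⟪x₃, x₃⟫ = ⟪x₄, x₄⟫
  inner_13 : ⟪x₁, x₃⟫ = ⟪x₂, x₄⟫
  inner_14 : ⟪x₁, x₄⟫ = -⟪x₂, x₃⟫

section IsotropicPair

variable {V : Type*} [NormedAddCommGroup V] [InnerProductSpace ℝ V]

lemma IsotropicPair.shear {x₁ x₂ x₃ x₄ : V} (h : IsotropicPair x₁ x₂ x₃ x₄) (s t : ℝ) :
    IsotropicPair x₁ x₂ (x₃ - s • x₁ + t • x₂) (x₄ - t • x₁ - s • x₂) := by
  obtain ⟨h12, h11, h34, h33, h13, h14⟩ := h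
  have c21 := real_inner_comm x₁ x₂
  have c31 := real_inner_comm x₁ x₃
  have c41 := real_inner_comm x₁ x₄
  have c32 := real_inner_comm x₂ x₃
  have c42 := real_inner_comm x₂ x₄
  refine ⟨h12, h11, ?_, ?_, ?_, ?_⟩ <;>
    simp only [inner_add_left, inner_add_right, inner_sub_left, inner_sub_right,
      real_inner_smul_left, real_inner_smul_right] <;> grind

lemma IsotropicPair.exists_shear_orthogonal {x₁ x₂ x₃ x₄ : V} (h : IsotropicPair x₁ x₂ x₃ x₄)
    (h1 : x₁ ≠ 0) : ∃ s t : ℝ, ⟪x₁, x₃ - s • x₁ + t • x₂⟫ = 0 ∧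
      ⟪x₁, x₄ - t • x₁ - s • x₂⟫ = 0 := by
  have h0 : ⟪x₁, x₁⟫ ≠ 0 := inner_self_ne_zero.mpr h1
  refine ⟨⟪x₁, x₃⟫ / ⟪x₁, x₁⟫, ⟪x₁, x₄⟫ / ⟪x₁, x₁⟫, ?_, ?_⟩ <;>
    simp only [inner_add_right, inner_sub_right, real_inner_smul_right, h.inner_12,
      div_mul_cancel₀ _ h0] <;> ring

lemma IsotropicPair.orthonormal {x₁ x₂ x₃ x₄ : V} (h : IsotropicPair x₁ x₂ x₃ x₄)
    (h13 : ⟪x₁, x₃⟫ = 0) (h14 : ⟪x₁, x₄⟫ = 0) (h1 : x₁ ≠ 0) (h3 : x₃ ≠ 0) :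
    Orthonormal ℝ ![‖x₁‖⁻¹ • x₁, ‖x₁‖⁻¹ • x₂, ‖x₃‖⁻¹ • x₃, ‖x₃‖⁻¹ • x₄] := by
  obtain ⟨h12, h11, h34, h33, h13', h14'⟩ := h
  have h24 : ⟪x₂, x₄⟫ = 0 := by rw [← h13', h13]
  have h23 : ⟪x₂, x₃⟫ = 0 := by linarith
  have n1 : ‖x₁‖ ≠ 0 := norm_ne_zero_iff.mpr h1
  have n3 : ‖x₃‖ ≠ 0 := norm_ne_zero_iff.mpr h3
  have n2 : ‖x₂‖ = ‖x₁‖ := by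
    rw [real_inner_self_eq_norm_sq, real_inner_self_eq_norm_sq] at h11
    exact ((sq_eq_sq₀ (norm_nonneg _) (norm_nonneg _)).mp h11).symm
  have n4 : ‖x₄‖ = ‖x₃‖ := by
    rw [real_inner_self_eq_norm_sq, real_inner_self_eq_norm_sq] at h33
    exact ((sq_eq_sq₀ (norm_nonneg _) (norm_nonneg _)).mp h33).symm
  constructor
  · intro i
    fin_cases i <;> simp [norm_smul, n1, n2, n3, n4]
  · intro i j hij
    fin_cases i <;> fin_cases j <;>
      simp_all [real_inner_smul_right, real_inner_comm]

lemma isotropicPair_curve {e v : Fin 4 → V} (he : Orthonormal ℝ e)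
    (hv : ∀ i j, ⟪e i, v j⟫ = 0) {a₁ a₂ b₁ b₂ c₁ c₂ : ℝ}
    (ha₁ : 4 * a₁ = ⟪v 1, v 1⟫ - ⟪v 0, v 0⟫) (ha₂ : 2 * a₂ = -⟪v 0, v 1⟫)
    (hb₁ : 2 * b₁ = ⟪v 1, v 3⟫ - ⟪v 0, v 2⟫) (hb₂ : 2 * b₂ = -⟪v 0, v 3⟫ - ⟪v 1, v 2⟫)
    (hc₁ : 4 * c₁ = ⟪v 3, v 3⟫ - ⟪v 2, v 2⟫) (hc₂ : 2 * c₂ = -⟪v 2, v 3⟫) (t : ℝ) :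
    IsotropicPair (e 0 + t • v 0 + t ^ 2 • (a₁ • e 0 + a₂ • e 1 + b₁ • e 2 + b₂ • e 3))
      (e 1 + t • v 1 + t ^ 2 • (a₂ • e 0 - a₁ • e 1 + b₂ • e 2 - b₁ • e 3))
      (e 2 + t • v 2 + t ^ 2 • (c₁ • e 2 + c₂ • e 3))
      (e 3 + t • v 3 + t ^ 2 • (c₂ • e 2 - c₁ • e 3)) := by
  have hee : ∀ i j, ⟪e i, e j⟫ = if i = j then 1 else 0 := orthonormal_iff_ite.mp he
  have hv' : ∀ i j, ⟪v j, e i⟫ = 0 := fun i j => by rw [real_inner_comm, hv]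
  have hij : ∀ (f g : Fin 4 → ℝ) (s : ℝ) (i j : Fin 4),
      ⟪e i + s • v i + s ^ 2 • ∑ k, f k • e k, e j + s • v j + s ^ 2 • ∑ k, g k • e k⟫ =
        (if i = j then 1 else 0) + s ^ 2 * (⟪v i, v j⟫ + f j + g i) + s ^ 4 * ∑ k, f k * g k := by
    intro f g s i j
    simp only [inner_add_left, inner_add_right, inner_sum, sum_inner, real_inner_smul_left,
      real_inner_smul_right, hee, hv, hv', mul_ite, mul_one, mul_zero, Finset.sum_ite_eq,
      Finset.sum_ite_eq', Finset.mem_univ, if_true, Finset.sum_const_zero, Finset.mul_sum]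
    have hgf : ∑ k, s ^ 2 * (g k * (s ^ 2 * f k)) = ∑ k, s ^ 4 * (f k * g k) :=
      Finset.sum_congr rfl fun k _ => by ring
    linear_combination hgf
  have h0 : a₁ • e 0 + a₂ • e 1 + b₁ • e 2 + b₂ • e 3 = ∑ k, ![a₁, a₂, b₁, b₂] k • e k := by
    simp [Fin.sum_univ_four]
  have h1 : a₂ • e 0 - a₁ • e 1 + b₂ • e 2 - b₁ • e 3 = ∑ k, ![a₂, -a₁, b₂, -b₁] k • e k := by
    simp [Fin.sum_univ_four, sub_eq_add_neg]
  have h2 : c₁ • e 2 + c₂ • e 3 = ∑ k, ![0, 0, c₁, c₂] k • e k := by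
    simp [Fin.sum_univ_four]
  have h3 : c₂ • e 2 - c₁ • e 3 = ∑ k, ![0, 0, c₂, -c₁] k • e k := by
    simp [Fin.sum_univ_four, sub_eq_add_neg]
  rw [h0, h1, h2, h3]
  constructor <;> simp only [hij]
  all_goals simp only [Fin.sum_univ_four, Matrix.cons_val, Fin.reduceEq, if_true, if_false]
  · linear_combination t ^ 2 * ha₂
  · linear_combination t ^ 2 * ha₁
  · linear_combination t ^ 2 * hc₂
  · linear_combination t ^ 2 * hc₁
  · linear_combination t ^ 2 * hb₁
  · linear_combination t ^ 2 * hb₂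

end IsotropicPair

lemma isotropicForm_shear {n : ℕ} {R : CurvMap n} (hR : IsCurvatureTensor R)
    (x₁ x₂ x₃ x₄ : Euc n) (s t : ℝ) :
    isotropicForm R x₁ x₂ (x₃ - s • x₁ + t • x₂) (x₄ - t • x₁ - s • x₂) =
      isotropicForm R x₁ x₂ x₃ x₄ := by
  obtain ⟨ha, hs, hB⟩ := hR
  have hz : ∀ x z w, R x x z w = 0 := fun x z w => by linarith [ha x x z w]
  have hz' : ∀ x z w, R z w x x = 0 := fun x z w => by rw [hs, hz]
  have ha' : ∀ x y z w, R z w x y = -R z w y x := fun x y z w => by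
    rw [hs, ha, hs]
  simp only [isotropicForm, map_add, map_sub, map_smul, LinearMap.add_apply, LinearMap.sub_apply,
    LinearMap.smul_apply, smul_eq_mul, hz, hz']
  simp only [ha x₂ x₁, ha' x₂ x₁, ha' x₃ x₁, ha' x₃ x₂, hs x₁ x₃ x₁ x₂, hs x₁ x₄ x₁ x₂,
    hs x₂ x₃ x₁ x₂, hs x₂ x₄ x₁ x₂]
  ring_nf

lemma isotropicForm_eq {n : ℕ} {R : CurvMap n} (hR : IsCurvatureTensor R)
    (x₁ x₂ x₃ x₄ : Euc n) :
    isotropicForm R x₁ x₂ x₃ x₄ = R x₁ x₃ x₁ x₃ + R x₁ x₄ x₁ x₄ + R x₂ x₃ x₂ x₃ + R x₂ x₄ x₂ x₄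
      - 2 * R x₁ x₃ x₂ x₄ + 2 * R x₁ x₄ x₂ x₃ := by
  obtain ⟨ha, hs, hB⟩ := hR
  rw [isotropicForm]
  linarith [hB x₁ x₂ x₃ x₄, ha x₃ x₁ x₂ x₄, hs x₂ x₃ x₁ x₄]

lemma isotropicForm_smul {n : ℕ} (R : CurvMap n) (x₁ x₂ x₃ x₄ : Euc n) (r s : ℝ) :
    isotropicForm R (r • x₁) (r • x₂) (s • x₃) (s • x₄) =
      r ^ 2 * s ^ 2 * isotropicForm R x₁ x₂ x₃ x₄ := by
  simp only [isotropicForm, map_smul, LinearMap.smul_apply, smul_eq_mul]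
  ring

lemma isotropicForm_nonneg_of_orthogonal {n : ℕ} {R : CurvMap n}
    (hnic : NonnegIsotropic (fun x y z w => R x y z w)) {x₁ x₂ x₃ x₄ : Euc n}
    (h : IsotropicPair x₁ x₂ x₃ x₄) (h13 : ⟪x₁, x₃⟫ = 0) (h14 : ⟪x₁, x₄⟫ = 0) :
    0 ≤ isotropicForm R x₁ x₂ x₃ x₄ := by
  by_cases h1 : x₁ = 0
  · have h2 : x₂ = 0 := by simpa [h1] using h.inner_11.symm
    simp [isotropicForm, h1, h2]
  by_cases h3 : x₃ = 0
  · have h4 : x₄ = 0 := by simpa [h3] using h.inner_33.symm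
    simp [isotropicForm, h3, h4]
  have key : 0 ≤ isotropicForm R (‖x₁‖⁻¹ • x₁) (‖x₁‖⁻¹ • x₂) (‖x₃‖⁻¹ • x₃) (‖x₃‖⁻¹ • x₄) :=
    hnic _ _ _ _ (h.orthonormal h13 h14 h1 h3)
  rw [isotropicForm_smul] at key
  have n1 := norm_pos_iff.mpr h1
  have n3 := norm_pos_iff.mpr h3
  exact nonneg_of_mul_nonneg_right key (by positivity)

lemma isotropicForm_nonneg {n : ℕ} {R : CurvMap n} (hR : IsCurvatureTensor R)
    (hnic : NonnegIsotropic (fun x y z w => R x y z w)) {x₁ x₂ x₃ x₄ : Euc n}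
    (h : IsotropicPair x₁ x₂ x₃ x₄) : 0 ≤ isotropicForm R x₁ x₂ x₃ x₄ := by
  by_cases h1 : x₁ = 0
  · have h2 : x₂ = 0 := by simpa [h1] using h.inner_11.symm
    simp [isotropicForm, h1, h2]
  obtain ⟨s, t, h13, h14⟩ := h.exists_shear_orthogonal h1
  rw [← isotropicForm_shear hR x₁ x₂ x₃ x₄ s t]
  exact isotropicForm_nonneg_of_orthogonal hnic (h.shear s t) h13 h14

lemma coeff_two_nonneg {p : Polynomial ℝ} (hp : ∀ t, 0 ≤ p.eval t) (h0 : p.coeff 0 = 0) :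
    0 ≤ p.coeff 2 := by
  obtain ⟨q, rfl⟩ := Polynomial.X_dvd_iff.mpr h0
  have hq : q.coeff 0 = 0 := by
    have hc : Continuous fun t => q.eval t := q.continuous
    rw [Polynomial.coeff_zero_eq_eval_zero]
    apply le_antisymm
    · refine le_of_tendsto (hc.continuousWithinAt (s := Set.Iio 0) (x := 0)) ?_
      filter_upwards [self_mem_nhdsWithin] with t ht
      have := hp t
      simp only [Polynomial.eval_mul, Polynomial.eval_X] at this
      exact nonpos_of_mul_nonneg_right this ht
    · refine ge_of_tendsto (hc.continuousWithinAt (s := Set.Ioi 0) (x := 0)) ?_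
      filter_upwards [self_mem_nhdsWithin] with t ht
      have := hp t
      simp only [Polynomial.eval_mul, Polynomial.eval_X] at this
      exact nonneg_of_mul_nonneg_right this ht
  obtain ⟨r, rfl⟩ := Polynomial.X_dvd_iff.mpr hq
  have hc : Continuous fun t => r.eval t := r.continuous
  simp only [Polynomial.coeff_X_mul]
  rw [Polynomial.coeff_zero_eq_eval_zero]
  refine ge_of_tendsto (hc.continuousWithinAt (s := Set.Ioi 0) (x := 0)) ?_
  filter_upwards [self_mem_nhdsWithin] with t ht
  have := hp t
  simp only [Polynomial.eval_mul, Polynomial.eval_X, ← mul_assoc] at this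
  exact nonneg_of_mul_nonneg_right this (mul_pos ht ht)

lemma sum_mul_nonneg {ι : Type*} [Fintype ι] [DecidableEq ι] {A B : Matrix ι ι ℝ}
    (hA : A.PosSemidef) (hB : B.PosSemidef) : 0 ≤ ∑ i, ∑ j, A i j * B i j := by
  obtain ⟨S, rfl⟩ : ∃ S : Matrix ι ι ℝ, A = S.conjTranspose * S := by
    open scoped MatrixOrder in
    exact CStarAlgebra.nonneg_iff_eq_star_mul_self.mp hA.nonneg
  have h : ∀ k, 0 ≤ ∑ i, ∑ j, S k i * S k j * B i j := fun k => by
    have := hB.dotProduct_mulVec_nonneg (S k)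
    simpa [dotProduct, Matrix.mulVec, Finset.mul_sum, mul_assoc, mul_comm, mul_left_comm] using this
  have h2 : ∑ i, ∑ j, (S.conjTranspose * S) i j * B i j =
      ∑ k, ∑ i, ∑ j, S k i * S k j * B i j := by
    simp only [Matrix.mul_apply, Finset.sum_mul, Matrix.conjTranspose_apply, star_trivial]
    rw [Finset.sum_comm]
    conv_rhs => rw [Finset.sum_comm]
    conv_rhs => enter [2, i]; rw [Finset.sum_comm]
    rw [Finset.sum_comm]
  rw [h2]
  exact Finset.sum_nonneg fun k _ => h k

/-- The coefficient of `t ^ 2` in `R` along the curves `x 0 + t • x 1 + t ^ 2 • x 2`,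
`x ∈ {a, b, c, d}`. -/
def quadCoeffTwo {n : ℕ} (R : CurvMap n) (a b c d : Fin 3 → Euc n) : ℝ :=
  R (a 2) (b 0) (c 0) (d 0) + R (a 0) (b 2) (c 0) (d 0) +
    R (a 0) (b 0) (c 2) (d 0) + R (a 0) (b 0) (c 0) (d 2) +
    (R (a 1) (b 1) (c 0) (d 0) + R (a 1) (b 0) (c 1) (d 0) + R (a 1) (b 0) (c 0) (d 1) +
    R (a 0) (b 1) (c 1) (d 0) + R (a 0) (b 1) (c 0) (d 1) + R (a 0) (b 0) (c 1) (d 1))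

/-- The coefficient of `t ^ 2` in the isotropic form along the curves
`x 0 + t • x 1 + t ^ 2 • x 2`, `x ∈ {a, b, c, d}`. -/
def isotropicFormCoeffTwo {n : ℕ} (R : CurvMap n) (a b c d : Fin 3 → Euc n) : ℝ :=
  quadCoeffTwo R a c a c + quadCoeffTwo R a d a d + quadCoeffTwo R b c b c +
    quadCoeffTwo R b d b d - 2 * quadCoeffTwo R a c b d + 2 * quadCoeffTwo R a d b c

lemma exists_polynomial_apply_curve {n : ℕ} (R : CurvMap n) (a b c d : Fin 3 → Euc n) :
    ∃ p : Polynomial ℝ,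
      (∀ t : ℝ, p.eval t = R (a 0 + t • a 1 + t ^ 2 • a 2) (b 0 + t • b 1 + t ^ 2 • b 2)
        (c 0 + t • c 1 + t ^ 2 • c 2) (d 0 + t • d 1 + t ^ 2 • d 2)) ∧
      p.coeff 0 = R (a 0) (b 0) (c 0) (d 0) ∧
      p.coeff 2 = quadCoeffTwo R a b c d := by
  refine ⟨∑ i : Fin 3, ∑ j : Fin 3, ∑ k : Fin 3, ∑ l : Fin 3,
    Polynomial.C (R (a i) (b j) (c k) (d l)) * Polynomial.X ^ (i + j + k + l : ℕ), ?_, ?_, ?_⟩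
  · intro t
    simp only [Fin.sum_univ_three, Polynomial.eval_add, Polynomial.eval_mul, Polynomial.eval_C,
      Polynomial.eval_pow, Polynomial.eval_X, map_add, map_smul, LinearMap.add_apply,
      LinearMap.smul_apply, smul_eq_mul, Fin.val_zero, Fin.val_one, Fin.val_two]
    ring
  · simp [Fin.sum_univ_three, Polynomial.coeff_X_pow]
  · simp [Fin.sum_univ_three, Polynomial.coeff_X_pow, quadCoeffTwo]
    ring

lemma exists_polynomial_isotropicForm_curve {n : ℕ} {R : CurvMap n}
    (hR : IsCurvatureTensor R) (a b c d : Fin 3 → Euc n) :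
    ∃ p : Polynomial ℝ,
      (∀ t : ℝ, p.eval t = isotropicForm R (a 0 + t • a 1 + t ^ 2 • a 2)
        (b 0 + t • b 1 + t ^ 2 • b 2) (c 0 + t • c 1 + t ^ 2 • c 2)
        (d 0 + t • d 1 + t ^ 2 • d 2)) ∧
      p.coeff 0 = isotropicForm R (a 0) (b 0) (c 0) (d 0) ∧
      p.coeff 2 = isotropicFormCoeffTwo R a b c d := by
  obtain ⟨p₁, h₁, h₁', h₁''⟩ := exists_polynomial_apply_curve R a c a c
  obtain ⟨p₂, h₂, h₂', h₂''⟩ := exists_polynomial_apply_curve R a d a d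
  obtain ⟨p₃, h₃, h₃', h₃''⟩ := exists_polynomial_apply_curve R b c b c
  obtain ⟨p₄, h₄, h₄', h₄''⟩ := exists_polynomial_apply_curve R b d b d
  obtain ⟨p₅, h₅, h₅', h₅''⟩ := exists_polynomial_apply_curve R a c b d
  obtain ⟨p₆, h₆, h₆', h₆''⟩ := exists_polynomial_apply_curve R a d b c
  refine ⟨p₁ + p₂ + p₃ + p₄ - Polynomial.C 2 * p₅ + Polynomial.C 2 * p₆, fun t => ?_, ?_, ?_⟩
  · simp [isotropicForm_eq hR, h₁, h₂, h₃, h₄, h₅, h₆]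
  · simp [isotropicForm_eq hR, h₁', h₂', h₃', h₄', h₅', h₆']
  · simp only [Polynomial.coeff_add, Polynomial.coeff_sub, Polynomial.coeff_C_mul, h₁'', h₂'',
      h₃'', h₄'', h₅'', h₆'', isotropicFormCoeffTwo]

/-- The second variation of the isotropic curvature at the frame `e`, averaged over the complex
rotation `(v₁ + i v₂, v₃ + i v₄) ↦ i (v₁ + i v₂, v₃ + i v₄)`. -/
def averagedSecondVariation {n : ℕ} (R : CurvMap n) (e v : Fin 4 → Euc n) : ℝ :=
  R (e 2) (v 0) (e 2) (v 0) + R (e 3) (v 0) (e 3) (v 0)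
    + R (e 2) (v 1) (e 2) (v 1) + R (e 3) (v 1) (e 3) (v 1)
    - 2 * (R (e 2) (v 0) (e 3) (v 1) - R (e 2) (v 1) (e 3) (v 0))
    + R (e 0) (v 2) (e 0) (v 2) + R (e 1) (v 2) (e 1) (v 2)
    + R (e 0) (v 3) (e 0) (v 3) + R (e 1) (v 3) (e 1) (v 3)
    - 2 * (R (e 0) (v 2) (e 1) (v 3) - R (e 0) (v 3) (e 1) (v 2))
    - 2 * (R (e 2) (v 0) (e 0) (v 2) + R (e 3) (v 0) (e 1) (v 2))
    - 2 * (R (e 2) (v 1) (e 0) (v 3) + R (e 3) (v 1) (e 1) (v 3))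
    - 2 * (R (e 3) (v 0) (e 0) (v 3) - R (e 2) (v 0) (e 1) (v 3))
    + 2 * (R (e 3) (v 1) (e 0) (v 2) - R (e 2) (v 1) (e 1) (v 2))

lemma isotropicFormCoeffTwo_nonneg {n : ℕ} {R : CurvMap n} (hR : IsCurvatureTensor R)
    (hnic : NonnegIsotropic (fun x y z w => R x y z w)) {e : Fin 4 → Euc n}
    (he : Orthonormal ℝ e) (h0 : isotropicForm R (e 0) (e 1) (e 2) (e 3) = 0)
    {v : Fin 4 → Euc n} (hv : ∀ i j, ⟪e i, v j⟫ = 0) {a₁ a₂ b₁ b₂ c₁ c₂ : ℝ}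
    (ha₁ : 4 * a₁ = ⟪v 1, v 1⟫ - ⟪v 0, v 0⟫) (ha₂ : 2 * a₂ = -⟪v 0, v 1⟫)
    (hb₁ : 2 * b₁ = ⟪v 1, v 3⟫ - ⟪v 0, v 2⟫) (hb₂ : 2 * b₂ = -⟪v 0, v 3⟫ - ⟪v 1, v 2⟫)
    (hc₁ : 4 * c₁ = ⟪v 3, v 3⟫ - ⟪v 2, v 2⟫) (hc₂ : 2 * c₂ = -⟪v 2, v 3⟫) :
    0 ≤ isotropicFormCoeffTwo R ![e 0, v 0, a₁ • e 0 + a₂ • e 1 + b₁ • e 2 + b₂ • e 3]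
      ![e 1, v 1, a₂ • e 0 - a₁ • e 1 + b₂ • e 2 - b₁ • e 3]
      ![e 2, v 2, c₁ • e 2 + c₂ • e 3] ![e 3, v 3, c₂ • e 2 - c₁ • e 3] := by
  obtain ⟨p, hp, hp0, hp2⟩ := exists_polynomial_isotropicForm_curve hR
    ![e 0, v 0, a₁ • e 0 + a₂ • e 1 + b₁ • e 2 + b₂ • e 3]
    ![e 1, v 1, a₂ • e 0 - a₁ • e 1 + b₂ • e 2 - b₁ • e 3]
    ![e 2, v 2, c₁ • e 2 + c₂ • e 3] ![e 3, v 3, c₂ • e 2 - c₁ • e 3]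
  rw [← hp2]
  refine coeff_two_nonneg (fun t => ?_) (hp0.trans h0)
  rw [hp]
  exact isotropicForm_nonneg hR hnic (isotropicPair_curve he hv ha₁ ha₂ hb₁ hb₂ hc₁ hc₂ t)

lemma isotropicFormCoeffTwo_add_rotation {n : ℕ} {R : CurvMap n} (hR : IsCurvatureTensor R)
    (e v u : Fin 4 → Euc n) :
    isotropicFormCoeffTwo R ![e 0, v 0, u 0] ![e 1, v 1, u 1] ![e 2, v 2, u 2] ![e 3, v 3, u 3] +
      isotropicFormCoeffTwo R ![e 0, -v 1, -u 0] ![e 1, v 0, -u 1] ![e 2, -v 3, -u 2]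
        ![e 3, v 2, -u 3] = 2 * averagedSecondVariation R e v := by
  obtain ⟨hA, hS, -⟩ := hR
  have hn : ∀ x y z w, R (-x) y z w = -R x y z w := fun x y z w => by
    rw [hA, map_neg, LinearMap.neg_apply, LinearMap.neg_apply, ← hA]
  have hve : ∀ i j z w, R (v i) (e j) z w = -R (e j) (v i) z w := fun i j z w => hA _ _ _ _
  have hve' : ∀ i j z w, R z w (v i) (e j) = -R z w (e j) (v i) := fun i j z w => by
    rw [hS, hA, hS]
  have hvv : ∀ i j k l, R (v i) (v j) (e k) (e l) = R (e k) (e l) (v i) (v j) :=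
    fun i j k l => hS _ _ _ _
  have h20 : ∀ i j, R (e 2) (v i) (e 0) (v j) = R (e 0) (v j) (e 2) (v i) := fun i j => hS _ _ _ _
  have h30 : ∀ i j, R (e 3) (v i) (e 0) (v j) = R (e 0) (v j) (e 3) (v i) := fun i j => hS _ _ _ _
  have h21 : ∀ i j, R (e 2) (v i) (e 1) (v j) = R (e 1) (v j) (e 2) (v i) := fun i j => hS _ _ _ _
  have h31 : ∀ i j, R (e 3) (v i) (e 1) (v j) = R (e 1) (v j) (e 3) (v i) := fun i j => hS _ _ _ _
  have h32 : ∀ i j, R (e 3) (v i) (e 2) (v j) = R (e 2) (v j) (e 3) (v i) := fun i j => hS _ _ _ _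
  simp only [averagedSecondVariation, isotropicFormCoeffTwo, quadCoeffTwo, Matrix.cons_val,
    hn, map_neg, LinearMap.neg_apply, hve, hve', hvv, h20, h30, h21, h31, h32]
  ring

lemma averagedSecondVariation_nonneg {n : ℕ} {R : CurvMap n} (hR : IsCurvatureTensor R)
    (hnic : NonnegIsotropic (fun x y z w => R x y z w)) {e : Fin 4 → Euc n}
    (he : Orthonormal ℝ e) (h0 : isotropicForm R (e 0) (e 1) (e 2) (e 3) = 0)
    {v : Fin 4 → Euc n} (hv : ∀ i j, ⟪e i, v j⟫ = 0) :
    0 ≤ averagedSecondVariation R e v := by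
  obtain ⟨a₁, ha₁⟩ : ∃ a, 4 * a = ⟪v 1, v 1⟫ - ⟪v 0, v 0⟫ := ⟨_, mul_div_cancel₀ _ (by norm_num)⟩
  obtain ⟨a₂, ha₂⟩ : ∃ a, 2 * a = -⟪v 0, v 1⟫ := ⟨_, mul_div_cancel₀ _ (by norm_num)⟩
  obtain ⟨b₁, hb₁⟩ : ∃ a, 2 * a = ⟪v 1, v 3⟫ - ⟪v 0, v 2⟫ := ⟨_, mul_div_cancel₀ _ (by norm_num)⟩
  obtain ⟨b₂, hb₂⟩ : ∃ a, 2 * a = -⟪v 0, v 3⟫ - ⟪v 1, v 2⟫ := ⟨_, mul_div_cancel₀ _ (by norm_num)⟩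
  obtain ⟨c₁, hc₁⟩ : ∃ a, 4 * a = ⟪v 3, v 3⟫ - ⟪v 2, v 2⟫ := ⟨_, mul_div_cancel₀ _ (by norm_num)⟩
  obtain ⟨c₂, hc₂⟩ : ∃ a, 2 * a = -⟪v 2, v 3⟫ := ⟨_, mul_div_cancel₀ _ (by norm_num)⟩
  have key := isotropicFormCoeffTwo_nonneg hR hnic he h0 hv ha₁ ha₂ hb₁ hb₂ hc₁ hc₂
  have key' := isotropicFormCoeffTwo_nonneg hR hnic he h0 (v := ![-v 1, v 0, -v 3, v 2])
    (a₁ := -a₁) (a₂ := -a₂) (b₁ := -b₁) (b₂ := -b₂) (c₁ := -c₁) (c₂ := -c₂)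
    (fun i j => by fin_cases j <;> simp [hv])
    (by simp only [Matrix.cons_val, inner_neg_neg]; linarith)
    (by simp only [Matrix.cons_val, inner_neg_left]; rw [real_inner_comm]; linarith)
    (by simp only [Matrix.cons_val, inner_neg_neg]; linarith)
    (by simp only [Matrix.cons_val, inner_neg_left, inner_neg_right]; linarith)
    (by simp only [Matrix.cons_val, inner_neg_neg]; linarith)
    (by simp only [Matrix.cons_val, inner_neg_left]; rw [real_inner_comm]; linarith)
  have h := isotropicFormCoeffTwo_add_rotation hR e v
    ![a₁ • e 0 + a₂ • e 1 + b₁ • e 2 + b₂ • e 3, a₂ • e 0 - a₁ • e 1 + b₂ • e 2 - b₁ • e 3,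
      c₁ • e 2 + c₂ • e 3, c₂ • e 2 - c₁ • e 3]
  simp only [Matrix.cons_val] at h key'
  have n0 : -a₁ • e 0 + -a₂ • e 1 + -b₁ • e 2 + -b₂ • e 3 =
    -(a₁ • e 0 + a₂ • e 1 + b₁ • e 2 + b₂ • e 3) := by module
  have n1 : -a₂ • e 0 - -a₁ • e 1 + -b₂ • e 2 - -b₁ • e 3 =
    -(a₂ • e 0 - a₁ • e 1 + b₂ • e 2 - b₁ • e 3) := by module
  have n2 : -c₁ • e 2 + -c₂ • e 3 = -(c₁ • e 2 + c₂ • e 3) := by module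
  have n3 : -c₂ • e 2 - -c₁ • e 3 = -(c₂ • e 2 - c₁ • e 3) := by module
  rw [n0, n1, n2, n3] at key'
  linarith

/-- The block matrix, with bilinear forms as entries, of the averaged second variation. -/
def secondVariationBlock {n : ℕ} (R : CurvMap n) (e : Fin 4 → Euc n) :
    Fin 4 → Fin 4 → Euc n →ₗ[ℝ] Euc n →ₗ[ℝ] ℝ :=
  let S : Fin 4 → Fin 4 → Euc n →ₗ[ℝ] Euc n →ₗ[ℝ] ℝ := fun i j => (R (e i)).flip (e j)
  let A := S 0 0 + S 1 1
  let B := S 2 2 + S 3 3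
  let C := S 2 0 + S 3 1
  let C' := S 0 2 + S 1 3
  let D := S 3 0 - S 2 1
  let D' := S 0 3 - S 1 2
  let P := R (e 0) (e 1)
  let Q := R (e 2) (e 3)
  ![![B, -Q, -C, -D], ![Q, B, D, -C], ![-C', D', A, -P], ![-D', -C', P, A]]

/-- The matrix of the averaged second variation on the span of the vectors `f`. -/
def secondVariationMatrix {n : ℕ} {ι : Type*} (R : CurvMap n) (e : Fin 4 → Euc n)
    (f : ι → Euc n) : Matrix (Fin 4 × ι) (Fin 4 × ι) ℝ :=
  fun x y => secondVariationBlock R e x.1 y.1 (f x.2) (f y.2)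

lemma sum_secondVariationBlock {n : ℕ} {R : CurvMap n} (hR : IsCurvatureTensor R)
    (e v : Fin 4 → Euc n) :
    ∑ i, ∑ j, secondVariationBlock R e i j (v i) (v j) = averagedSecondVariation R e v := by
  obtain ⟨hA, hS, hB⟩ := hR
  have hP : ∀ x y z w, R x y z w = R x z y w - R x w y z := fun x y z w => by
    linarith [hB x y z w, hA z x y w, hS y z x w]
  simp only [Fin.sum_univ_four, secondVariationBlock, averagedSecondVariation, Matrix.cons_val,
    LinearMap.add_apply, LinearMap.sub_apply, LinearMap.neg_apply, LinearMap.flip_apply,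
    hP (e 0) (e 1), hP (e 2) (e 3), hS (e 2) _ (e 0) _, hS (e 3) _ (e 0) _, hS (e 2) _ (e 1) _,
    hS (e 3) _ (e 1) _]
  ring

lemma secondVariationBlock_symm {n : ℕ} {R : CurvMap n} (hR : IsCurvatureTensor R)
    (e : Fin 4 → Euc n) (i j : Fin 4) (x y : Euc n) :
    secondVariationBlock R e j i y x = secondVariationBlock R e i j x y := by
  obtain ⟨hA, hS, -⟩ := hR
  have hA' : ∀ z w, R z w y x = -R z w x y := fun z w => by rw [hS, hA, hS]
  have hS' : ∀ z w, R z y w x = R w x z y := fun z w => hS _ _ _ _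
  fin_cases i <;> fin_cases j <;>
    simp [secondVariationBlock, hA', hS']

lemma posSemidef_secondVariationMatrix {n : ℕ} {ι : Type*} [Fintype ι] {R : CurvMap n}
    (hR : IsCurvatureTensor R) (hnic : NonnegIsotropic (fun x y z w => R x y z w))
    {e : Fin 4 → Euc n} (he : Orthonormal ℝ e)
    (h0 : isotropicForm R (e 0) (e 1) (e 2) (e 3) = 0) {f : ι → Euc n}
    (hf : ∀ i p, ⟪e i, f p⟫ = 0) : (secondVariationMatrix R e f).PosSemidef := by
  refine .of_dotProduct_mulVec_nonneg ?_ fun x => ?_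
  · ext ⟨i, p⟩ ⟨j, q⟩
    exact secondVariationBlock_symm hR e i j (f p) (f q)
  · have h := averagedSecondVariation_nonneg hR hnic he h0
      (v := fun i => ∑ p, x (i, p) • f p) fun i j => by
        simp [inner_sum, real_inner_smul_right, hf]
    rw [← sum_secondVariationBlock hR] at h
    refine h.trans_eq ?_
    simp only [dotProduct, Matrix.mulVec, secondVariationMatrix, Fintype.sum_prod_type, map_sum,
      LinearMap.sum_apply, map_smul, LinearMap.smul_apply, smul_eq_mul, Finset.mul_sum,
      Pi.star_apply, star_trivial]
    refine Finset.sum_congr rfl fun i _ => ?_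
    conv_rhs => rw [Finset.sum_comm]
    refine Finset.sum_congr rfl fun j _ => ?_
    conv_lhs => rw [Finset.sum_comm]
    refine Finset.sum_congr rfl fun p _ => Finset.sum_congr rfl fun q _ => ?_
    ring

lemma sum_curvature_nonneg {n : ℕ} {ι : Type*} [Fintype ι] {R : CurvMap n}
    (hR : IsCurvatureTensor R) (hnic : NonnegIsotropic (fun x y z w => R x y z w))
    {e : Fin 4 → Euc n} (he : Orthonormal ℝ e)
    (h0 : isotropicForm R (e 0) (e 1) (e 2) (e 3) = 0) {f : ι → Euc n}
    (hf : ∀ i p, ⟪e i, f p⟫ = 0) :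
    0 ≤ ∑ p, ∑ q, ((R (e 0) (f p) (e 0) (f q) + R (e 1) (f p) (e 1) (f q)) *
          (R (e 2) (f p) (e 2) (f q) + R (e 3) (f p) (e 3) (f q))
        - R (e 0) (e 1) (f p) (f q) * R (e 2) (e 3) (f p) (f q)
        - (R (e 0) (f p) (e 2) (f q) + R (e 1) (f p) (e 3) (f q)) *
          (R (e 2) (f p) (e 0) (f q) + R (e 3) (f p) (e 1) (f q))
        - (R (e 0) (f p) (e 3) (f q) - R (e 1) (f p) (e 2) (f q)) *
          (R (e 3) (f p) (e 0) (f q) - R (e 2) (f p) (e 1) (f q))) := by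
  classical
  have hL := posSemidef_secondVariationMatrix hR hnic he h0 hf
  let s : Fin 4 × ι → ℝ := fun x => ![-1, 1, 1, -1] x.1
  let σ : Fin 4 × ι → Fin 4 × ι := fun x => (![2, 3, 0, 1] x.1, x.2)
  have h := sum_mul_nonneg hL
    ((hL.submatrix σ).conjTranspose_mul_mul_same (Matrix.diagonal s))
  simp only [Matrix.diagonal_conjTranspose, Matrix.mul_diagonal, Matrix.diagonal_mul,
    Matrix.submatrix_apply, Fintype.sum_prod_type, star_trivial] at h
  rw [Finset.sum_comm] at h
  have h' : ∀ p : ι, ∑ i : Fin 4, ∑ j : Fin 4, ∑ q : ι, secondVariationMatrix R e f (i, p) (j, q) *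
      (s (i, p) * secondVariationMatrix R e f (σ (i, p)) (σ (j, q)) * s (j, q)) =
      ∑ q, 4 * ((R (e 0) (f p) (e 0) (f q) + R (e 1) (f p) (e 1) (f q)) *
          (R (e 2) (f p) (e 2) (f q) + R (e 3) (f p) (e 3) (f q))
        - R (e 0) (e 1) (f p) (f q) * R (e 2) (e 3) (f p) (f q)
        - (R (e 0) (f p) (e 2) (f q) + R (e 1) (f p) (e 3) (f q)) *
          (R (e 2) (f p) (e 0) (f q) + R (e 3) (f p) (e 1) (f q))
        - (R (e 0) (f p) (e 3) (f q) - R (e 1) (f p) (e 2) (f q)) *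
          (R (e 3) (f p) (e 0) (f q) - R (e 2) (f p) (e 1) (f q))) := by
    intro p
    simp only [Fin.sum_univ_four, ← Finset.sum_add_distrib]
    refine Finset.sum_congr rfl fun q _ => ?_
    simp only [s, σ, secondVariationMatrix, secondVariationBlock, Matrix.cons_val,
      LinearMap.add_apply, LinearMap.sub_apply, LinearMap.neg_apply, LinearMap.flip_apply]
    ring
  simp only [h', ← Finset.mul_sum] at h
  linarith

/-- Proposition `p.and.q.bigger.than.4`: the inequality for the sums over `p, q = 5, …, n`,
at a frame where the isotropic curvature attains its minimum value zero. -/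
theorem stmt_14 {n : ℕ} (hn : 4 ≤ n) (R : CurvMap n) (hR : IsCurvatureTensor R)
    (b : OrthonormalBasis (Fin n) ℝ (Euc n))
    (hnic : NonnegIsotropic (fun x y z w => R x y z w)) :
    let e₁ : Euc n := b ⟨0, by omega⟩
    let e₂ : Euc n := b ⟨1, by omega⟩
    let e₃ : Euc n := b ⟨2, by omega⟩
    let e₄ : Euc n := b ⟨3, by omega⟩
    let H : Finset (Fin n) := Finset.univ.filter fun p : Fin n => 4 ≤ (p : ℕ)
    R e₁ e₃ e₁ e₃ + R e₁ e₄ e₁ e₄ + R e₂ e₃ e₂ e₃ + R e₂ e₄ e₂ e₄ - 2 * R e₁ e₂ e₃ e₄ = 0 →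
    (∑ p ∈ H, ∑ q ∈ H,
        (R e₁ (b p) e₁ (b q) + R e₂ (b p) e₂ (b q)) *
          (R e₃ (b p) e₃ (b q) + R e₄ (b p) e₄ (b q)))
      - (∑ p ∈ H, ∑ q ∈ H, R e₁ e₂ (b p) (b q) * R e₃ e₄ (b p) (b q))
    ≥ (∑ p ∈ H, ∑ q ∈ H,
        (R e₁ (b p) e₃ (b q) + R e₂ (b p) e₄ (b q)) *
          (R e₃ (b p) e₁ (b q) + R e₄ (b p) e₂ (b q)))
      + (∑ p ∈ H, ∑ q ∈ H,
        (R e₁ (b p) e₄ (b q) - R e₂ (b p) e₃ (b q)) *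
          (R e₄ (b p) e₁ (b q) - R e₃ (b p) e₂ (b q))) := by
  intro e₁ e₂ e₃ e₄ H h0
  let e : Fin 4 → Euc n := fun i => b (Fin.castLE hn i)
  have he : Orthonormal ℝ e := b.orthonormal.comp _ (Fin.castLE_injective hn)
  have hf : ∀ (i : Fin 4) (p : H), ⟪e i, b p⟫ = 0 := fun i p => by
    refine b.orthonormal.2 fun hip => ?_
    have hp : 4 ≤ (p : Fin n).val := (Finset.mem_filter.mp p.2).2
    rw [← hip, Fin.val_castLE] at hp
    omega
  have hsum : ∀ g : Fin n → Fin n → ℝ, ∑ p : H, ∑ q : H, g p q = ∑ p ∈ H, ∑ q ∈ H, g p q :=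
    fun g => by
      rw [← Finset.sum_coe_sort H]
      exact Finset.sum_congr rfl fun p _ => Finset.sum_coe_sort H (g p)
  have h := (sum_curvature_nonneg hR hnic he h0 hf).trans_eq (hsum fun p q =>
        (R e₁ (b p) e₁ (b q) + R e₂ (b p) e₂ (b q)) *
          (R e₃ (b p) e₃ (b q) + R e₄ (b p) e₄ (b q))
        - R e₁ e₂ (b p) (b q) * R e₃ e₄ (b p) (b q)
        - (R e₁ (b p) e₃ (b q) + R e₂ (b p) e₄ (b q)) *
          (R e₃ (b p) e₁ (b q) + R e₄ (b p) e₂ (b q))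
        - (R e₁ (b p) e₄ (b q) - R e₂ (b p) e₃ (b q)) *
          (R e₄ (b p) e₁ (b q) - R e₃ (b p) e₂ (b q)))
  simp only [Finset.sum_sub_distrib] at h
  linarith
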